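/- Let U, Ubar ∈ ℝ^{N×n} have orthonormal columns whose local coherences satisfy, for a bijection j of {1,…,N}, γ_{j(i)}(U) ≤ c_4·exp(−c_5·i^a) and γ_{j(i)}(Ubar) ≤ cbar_4·exp(−cbar_5·i^{abar}) with constants c_4, cbar_4, c_5, cbar_5 > 0 and a, abar > 1. Let Ftilde ∈ ℝ^{n×n} be invertible and F = Ubar·Ftilde, let P be an interpolation points matrix with PᵀU invertible and PᵀF of rank n, set C = (PᵀU)^{-1}PᵀF, R = UC − F, and Λ = ‖(PᵀU)^{-1}‖₂. Let S be the sampling points matrix selecting m indices i with the m largest component-wise residuals ‖Rᵀe_i‖₂² (adaptive sampling), with complementary matrix Sbreve, and suppose ΔU ∈ ℝ^{N×n} satisfies SbreveᵀΔU = 0 and Sᵀ((U + ΔU)C − F) = 0, with U + ΔU of rank n and orthonormal basis matrix Uhat of its column span. Then ‖Ubar − Uhat Uhatᵀ Ubar‖_F² ≤ (c_7 / (1 − exp(−min{c_5, cbar_5}))) · (n/N) · κ(Ftilde)² · exp(−min{c_5, cbar_5}·m^{min{a, abar}}), where c_7 = (√(cbar_4) + Λ·√(c_4))² and κ(Ftilde)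 is the spectral condition number of Ftilde. -/

import Mathlib

open Matrix Finset

/-- Squared Frobenius norm of a real matrix. -/
noncomputable def frobSq {m k : ℕ} (A : Matrix (Fin m) (Fin k) ℝ) : ℝ :=
  ∑ i, ∑ j, A i j ^ 2

/-- Squared Euclidean norm of the `i`-th row of `A`, i.e. `‖Aᵀ e_i‖₂²`. -/
noncomputable def rowNormSq {m k : ℕ} (A : Matrix (Fin m) (Fin k) ℝ) (i : Fin m) : ℝ :=
  ∑ j, A i j ^ 2

/-- The matrix `[e_{s 0}, …, e_{s (m-1)}] ∈ ℝ^{N×m}` whose columns are the canonical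
unit vectors of `ℝ^N` selected by `s`. -/
noncomputable def samplingMatrix {N m : ℕ} (s : Fin m → Fin N) : Matrix (Fin N) (Fin m) ℝ :=
  Matrix.of fun i k => if i = s k then 1 else 0

/-- Spectral norm (operator 2-norm) of a real matrix. -/
noncomputable def specNorm {m k : ℕ} (A : Matrix (Fin m) (Fin k) ℝ) : ℝ :=
  ‖LinearMap.toContinuousLinearMap (Matrix.toEuclideanLin A)‖

open scoped Matrix.Norms.L2Operator in
theorem specNorm_eq_l2_opNorm {m k : ℕ} (A : Matrix (Fin m) (Fin k) ℝ) : specNorm A = ‖A‖ :=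
  (Matrix.l2_opNorm_def A).symm

theorem specNorm_nonneg {m k : ℕ} (A : Matrix (Fin m) (Fin k) ℝ) : 0 ≤ specNorm A :=
  norm_nonneg _

theorem specNorm_transpose {m k : ℕ} (A : Matrix (Fin m) (Fin k) ℝ) :
    specNorm Aᵀ = specNorm A := by
  rw [specNorm_eq_l2_opNorm, specNorm_eq_l2_opNorm, ← conjTranspose_eq_transpose_of_trivial]
  exact Matrix.l2_opNorm_conjTranspose A

theorem specNorm_mul_le {m k l : ℕ} (A : Matrix (Fin m) (Fin k) ℝ)
    (B : Matrix (Fin k) (Fin l) ℝ) : specNorm (A * B) ≤ specNorm A * specNorm B := by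
  simp only [specNorm_eq_l2_opNorm]
  exact Matrix.l2_opNorm_mul A B

theorem specNorm_le_one {m k : ℕ} {V : Matrix (Fin m) (Fin k) ℝ} (hV : Vᵀ * V = 1) :
    specNorm V ≤ 1 := by
  have h := Matrix.l2_opNorm_conjTranspose_mul_self V
  rw [conjTranspose_eq_transpose_of_trivial, hV, ← specNorm_eq_l2_opNorm,
    ← specNorm_eq_l2_opNorm] at h
  have h1 : specNorm (1 : Matrix (Fin k) (Fin k) ℝ) ≤ 1 := by
    refine ContinuousLinearMap.opNorm_le_bound _ zero_le_one fun x => ?_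
    simp
  nlinarith [specNorm_nonneg V]

theorem rowNormSq_eq_norm_sq {m k : ℕ} (A : Matrix (Fin m) (Fin k) ℝ) (i : Fin m) :
    rowNormSq A i = ‖WithLp.toLp 2 (A i)‖ ^ 2 := by
  simp [rowNormSq, EuclideanSpace.norm_sq_eq]

theorem rowNormSq_nonneg {m k : ℕ} (A : Matrix (Fin m) (Fin k) ℝ) (i : Fin m) :
    0 ≤ rowNormSq A i :=
  Finset.sum_nonneg fun _ _ => sq_nonneg _

theorem norm_row_mul_le {m k l : ℕ} (A : Matrix (Fin m) (Fin k) ℝ)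
    (B : Matrix (Fin k) (Fin l) ℝ) (i : Fin m) :
    ‖WithLp.toLp 2 ((A * B) i)‖ ≤ ‖WithLp.toLp 2 (A i)‖ * specNorm B := by
  have h := Matrix.l2_opNorm_mulVec Bᵀ (WithLp.toLp 2 (A i))
  rw [← specNorm_eq_l2_opNorm, specNorm_transpose, mulVec_transpose, mul_comm] at h
  exact h

theorem rowNormSq_mul_le {m k l : ℕ} (A : Matrix (Fin m) (Fin k) ℝ)
    (B : Matrix (Fin k) (Fin l) ℝ) (i : Fin m) :
    rowNormSq (A * B) i ≤ rowNormSq A i * specNorm B ^ 2 := by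
  rw [rowNormSq_eq_norm_sq, rowNormSq_eq_norm_sq, ← mul_pow]
  exact pow_le_pow_left₀ (norm_nonneg _) (norm_row_mul_le A B i) 2

theorem frobSq_mul_le {m k l : ℕ} (A : Matrix (Fin m) (Fin k) ℝ)
    (B : Matrix (Fin k) (Fin l) ℝ) : frobSq (A * B) ≤ frobSq A * specNorm B ^ 2 := by
  unfold frobSq
  rw [Finset.sum_mul]
  exact Finset.sum_le_sum fun i _ => rowNormSq_mul_le A B i

theorem frobSq_eq_trace {m k : ℕ} (A : Matrix (Fin m) (Fin k) ℝ) :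
    frobSq A = (Aᵀ * A).trace := by
  simp only [frobSq, trace, Matrix.diag, mul_apply, transpose_apply, sq]
  exact Finset.sum_comm

theorem frobSq_nonneg {m k : ℕ} (A : Matrix (Fin m) (Fin k) ℝ) : 0 ≤ frobSq A :=
  Finset.sum_nonneg fun i _ => rowNormSq_nonneg A i

theorem frobSq_neg {m k : ℕ} (A : Matrix (Fin m) (Fin k) ℝ) : frobSq (-A) = frobSq A := by
  simp [frobSq]

/-- Projecting onto the orthogonal complement of a column span does not increase the
Frobenius norm. -/
theorem frobSq_sub_proj_le {m k l : ℕ} {V : Matrix (Fin m) (Fin k) ℝ} (hV : Vᵀ * V = 1)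
    (X : Matrix (Fin m) (Fin l) ℝ) : frobSq (X - V * Vᵀ * X) ≤ frobSq X := by
  have key : (X - V * Vᵀ * X)ᵀ * (X - V * Vᵀ * X) = Xᵀ * X - (Vᵀ * X)ᵀ * (Vᵀ * X) := by
    have hVV : Vᵀ * (V * (Vᵀ * X)) = Vᵀ * X := by rw [← Matrix.mul_assoc, hV, Matrix.one_mul]
    simp only [transpose_sub, transpose_mul, transpose_transpose, Matrix.sub_mul,
      Matrix.mul_sub, Matrix.mul_assoc, hVV]
    abel
  have h := frobSq_nonneg (Vᵀ * X)
  rw [frobSq_eq_trace] at h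
  rw [frobSq_eq_trace, frobSq_eq_trace, key, trace_sub]
  linarith

theorem samplingMatrix_transpose_mul {N m k : ℕ} (s : Fin m → Fin N)
    (A : Matrix (Fin N) (Fin k) ℝ) : (samplingMatrix s)ᵀ * A = A.submatrix s id := by
  ext i l
  simp [samplingMatrix, mul_apply]

theorem samplingMatrix_orthonormal {N m : ℕ} {s : Fin m → Fin N} (hs : Function.Injective s) :
    (samplingMatrix s)ᵀ * samplingMatrix s = 1 := by
  rw [samplingMatrix_transpose_mul]
  ext i l
  simp [samplingMatrix, one_apply, hs.eq_iff]

/-- A set carrying the largest values of `f` has the largest sum among sets of its cardinality. -/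
theorem sum_le_sum_of_card_eq_of_forall_le {ι : Type*} [DecidableEq ι] {T W : Finset ι}
    {f : ι → ℝ} (hcard : W.card = T.card) (hT : ∀ k ∈ T, ∀ i ∉ T, f i ≤ f k) :
    ∑ i ∈ W, f i ≤ ∑ i ∈ T, f i := by
  have hc : (W \ T).card = (T \ W).card := by
    have h₁ := Finset.card_sdiff_add_card_inter W T
    have h₂ := Finset.card_sdiff_add_card_inter T W
    rw [Finset.inter_comm] at h₂
    omega
  have hd : ∑ i ∈ W \ T, f i ≤ ∑ i ∈ T \ W, f i := by
    rcases (T \ W).eq_empty_or_nonempty with he | hne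
    · rw [he, Finset.card_empty, Finset.card_eq_zero] at hc
      rw [hc, he]
    · obtain ⟨k, hk, hmin⟩ := Finset.exists_min_image (T \ W) f hne
      calc ∑ i ∈ W \ T, f i ≤ (W \ T).card • f k :=
            Finset.sum_le_card_nsmul _ _ _ fun i hi =>
              hT k (Finset.mem_sdiff.1 hk).1 i (Finset.mem_sdiff.1 hi).2
        _ = (T \ W).card • f k := by rw [hc]
        _ ≤ ∑ i ∈ T \ W, f i := Finset.card_nsmul_le_sum _ _ _ hmin
  have h₁ := Finset.sum_inter_add_sum_sdiff W T f
  have h₂ := Finset.sum_inter_add_sum_sdiff T W f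
  rw [Finset.inter_comm] at h₂
  linarith

theorem sum_compl_le_sum_compl_of_card_eq {ι : Type*} [Fintype ι] [DecidableEq ι]
    {T W : Finset ι} {f : ι → ℝ} (hcard : W.card = T.card)
    (hT : ∀ k ∈ T, ∀ i ∉ T, f i ≤ f k) : ∑ i ∈ Tᶜ, f i ≤ ∑ i ∈ Wᶜ, f i := by
  have h := sum_le_sum_of_card_eq_of_forall_le hcard hT
  have h₁ := Finset.sum_add_sum_compl W f
  have h₂ := Finset.sum_add_sum_compl T f
  linarith

theorem exp_neg_mul_rpow_add_le {c α : ℝ} (hc : 0 < c) (hα : 1 ≤ α) (m k : ℕ) :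
    Real.exp (-c * ((m + k + 1 : ℕ) : ℝ) ^ α) ≤
      Real.exp (-c * (m : ℝ) ^ α) * Real.exp (-c) ^ k := by
  have h₁ : (m : ℝ) ^ α + ((k + 1 : ℕ) : ℝ) ^ α ≤ ((m + k + 1 : ℕ) : ℝ) ^ α := by
    have := Real.add_rpow_le_rpow_add (Nat.cast_nonneg m) (Nat.cast_nonneg (k + 1)) hα
    rwa [← Nat.cast_add, ← add_assoc] at this
  have h₂ : (k : ℝ) ≤ ((k + 1 : ℕ) : ℝ) ^ α := by
    have : (1 : ℝ) ≤ ((k + 1 : ℕ) : ℝ) := by norm_cast; omega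
    have h := Real.self_le_rpow_of_one_le this hα
    push_cast at h ⊢
    linarith
  rw [← Real.exp_nat_mul, ← Real.exp_add, Real.exp_le_exp]
  nlinarith

theorem sum_exp_neg_mul_rpow_le {N m : ℕ} {c α : ℝ} (hc : 0 < c) (hα : 1 ≤ α) :
    ∑ i ∈ univ.filter fun i : Fin N => m ≤ (i : ℕ), Real.exp (-c * (((i : ℕ) + 1 : ℕ) : ℝ) ^ α) ≤
      Real.exp (-c * (m : ℝ) ^ α) / (1 - Real.exp (-c)) := by
  have hlt : Real.exp (-c) < 1 := Real.exp_lt_one_iff.2 (neg_lt_zero.2 hc)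
  calc ∑ i ∈ univ.filter fun i : Fin N => m ≤ (i : ℕ), Real.exp (-c * (((i : ℕ) + 1 : ℕ) : ℝ) ^ α)
      ≤ ∑ i ∈ univ.filter fun i : Fin N => m ≤ (i : ℕ),
          Real.exp (-c * (m : ℝ) ^ α) * Real.exp (-c) ^ ((i : ℕ) - m) := by
        refine Finset.sum_le_sum fun i hi => ?_
        have hmi : m ≤ (i : ℕ) := (Finset.mem_filter.1 hi).2
        have h := exp_neg_mul_rpow_add_le hc hα m ((i : ℕ) - m)
        rwa [Nat.add_sub_cancel' hmi] at h
    _ = Real.exp (-c * (m : ℝ) ^ α) *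
          ∑ k ∈ (univ.filter fun i : Fin N => m ≤ (i : ℕ)).image (fun i : Fin N => (i : ℕ) - m),
            Real.exp (-c) ^ k := by
        rw [Finset.mul_sum, Finset.sum_image]
        intro x hx y hy hxy
        simp only [coe_filter, mem_univ, true_and, Set.mem_ofPred_eq] at hx hy
        ext
        dsimp only at hxy
        omega
    _ ≤ Real.exp (-c * (m : ℝ) ^ α) * ∑' k : ℕ, Real.exp (-c) ^ k := by
        refine mul_le_mul_of_nonneg_left ?_ (Real.exp_pos _).le
        exact (summable_geometric_of_lt_one (Real.exp_pos _).le hlt).sum_le_tsum _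
          fun k _ => pow_nonneg (Real.exp_pos _).le k
    _ = _ := by
        rw [tsum_geometric_of_lt_one (Real.exp_pos _).le hlt, div_eq_mul_inv]

/-- Coherence decay at a given rate implies decay of the row norms at any slower rate. -/
theorem norm_row_le_of_coherence {N n : ℕ} (hN : 0 < N) (hn : 0 < n)
    {V : Matrix (Fin N) (Fin n) ℝ} {i : Fin N} {b c α c' α' x : ℝ} (hb : 0 ≤ b) (hc' : 0 < c')
    (hx : 1 ≤ x) (hcc : c' ≤ c) (hαα : α' ≤ α)
    (h : (N : ℝ) / n * rowNormSq V i ≤ b * Real.exp (-c * x ^ α)) :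
    ‖WithLp.toLp 2 (V i)‖ ≤ √b * √((n : ℝ) / N * Real.exp (-c' * x ^ α')) := by
  have hN' : (0 : ℝ) < N := by exact_mod_cast hN
  have hn' : (0 : ℝ) < n := by exact_mod_cast hn
  rw [← Real.sqrt_mul hb]
  apply Real.le_sqrt_of_sq_le
  rw [← rowNormSq_eq_norm_sq]
  have hexp : Real.exp (-c * x ^ α) ≤ Real.exp (-c' * x ^ α') := by
    rw [Real.exp_le_exp]
    have h₁ : x ^ α' ≤ x ^ α := Real.rpow_le_rpow_of_exponent_le hx hαα
    have h₂ : 0 < x ^ α' := Real.rpow_pos_of_pos (by linarith) _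
    have := mul_le_mul hcc h₁ h₂.le (hc'.le.trans hcc)
    linarith
  calc rowNormSq V i = (n : ℝ) / N * ((N : ℝ) / n * rowNormSq V i) := by field_simp
    _ ≤ (n : ℝ) / N * (b * Real.exp (-c' * x ^ α')) := by
        refine mul_le_mul_of_nonneg_left ?_ (by positivity)
        exact h.trans (mul_le_mul_of_nonneg_left hexp hb)
    _ = _ := by ring

/-- Only the rows missed by `s` contribute to the error of a matrix agreeing with `R` there and
vanishing on the rows selected by `s`. -/
theorem frobSq_eq_sum_compl {N k m : ℕ} {s : Fin m → Fin N} {E R : Matrix (Fin N) (Fin k) ℝ}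
    (h₀ : ∀ l, E (s l) = 0) (h₁ : ∀ i ∉ Set.range s, E i = R i) :
    frobSq E = ∑ i ∈ (univ.image s)ᶜ, rowNormSq R i := by
  have hE : frobSq E = ∑ i, rowNormSq E i := rfl
  rw [hE, ← Finset.sum_add_sum_compl (univ.image s), Finset.sum_eq_zero, zero_add]
  · refine Finset.sum_congr rfl fun i hi => ?_
    have : i ∉ Set.range s := by simpa using hi
    simp only [rowNormSq, h₁ i this]
  · intro i hi
    obtain ⟨l, -, rfl⟩ := Finset.mem_image.1 hi
    simp [rowNormSq, h₀ l]

/-- (Proposition 3.5, deterministic core.)  Combining the local-coherence decay of the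
spaces spanned by `U` and `Ubar` with adaptive sampling (the sampling matrix `S` selects
`m` indices with the largest component-wise residuals) and a full-rank update supported on
the sampled rows, the adapted space with orthonormal basis `Uhat` satisfies
`‖Ubar − Uhat Uhatᵀ Ubar‖_F² ≤ (c₇/(1−exp(−min{c₅,c̄₅})))·(n/N)·κ(Ftilde)²·
 exp(−min{c₅,c̄₅}·m^{min{a,ā}})` with `c₇ = (√c̄₄ + Λ√c₄)²`, `Λ = ‖(PᵀU)⁻¹‖₂`, and
`κ(Ftilde) = ‖Ftilde‖₂·‖Ftilde⁻¹‖₂` the spectral condition number. -/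
theorem local_coherence_adapted_space_error_bound
    {N n m : ℕ} (hN : 0 < N) (hn : 0 < n) (hm : m ≤ N)
    (U Ubar : Matrix (Fin N) (Fin n) ℝ)
    (hU : Uᵀ * U = 1) (hUbar : Ubarᵀ * Ubar = 1)
    (j : Equiv.Perm (Fin N)) (c₄ cbar₄ c₅ cbar₅ a abar : ℝ)
    (hc₄ : 0 < c₄) (hcbar₄ : 0 < cbar₄) (hc₅ : 0 < c₅) (hcbar₅ : 0 < cbar₅)
    (ha : 1 < a) (habar : 1 < abar)
    (hcoh : ∀ i : Fin N, (N : ℝ) / n * rowNormSq U (j i) ≤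
      c₄ * Real.exp (-c₅ * (((i : ℕ) + 1 : ℕ) : ℝ) ^ a))
    (hcohbar : ∀ i : Fin N, (N : ℝ) / n * rowNormSq Ubar (j i) ≤
      cbar₄ * Real.exp (-cbar₅ * (((i : ℕ) + 1 : ℕ) : ℝ) ^ abar))
    (Ftilde : Matrix (Fin n) (Fin n) ℝ) (hFt : IsUnit Ftilde)
    (F : Matrix (Fin N) (Fin n) ℝ) (hF : F = Ubar * Ftilde)
    (p : Fin n → Fin N) (hp : Function.Injective p)
    (hPU : IsUnit ((samplingMatrix p)ᵀ * U))
    (hPF : ((samplingMatrix p)ᵀ * F).rank = n)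
    (C : Matrix (Fin n) (Fin n) ℝ)
    (hC : C = ((samplingMatrix p)ᵀ * U)⁻¹ * ((samplingMatrix p)ᵀ * F))
    (R : Matrix (Fin N) (Fin n) ℝ) (hR : R = U * C - F)
    (s : Fin m → Fin N) (hs : Function.Injective s)
    (hadapt : ∀ (k : Fin m) (i : Fin N),
      i ∉ Set.range s → rowNormSq R i ≤ rowNormSq R (s k))
    (sb : Fin (N - m) → Fin N) (hsb : Function.Injective sb)
    (hcompl : Set.range sb = (Set.range s)ᶜ)
    (ΔU : Matrix (Fin N) (Fin n) ℝ)
    (h1 : (samplingMatrix sb)ᵀ * ΔU = 0)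
    (h2 : (samplingMatrix s)ᵀ * ((U + ΔU) * C - F) = 0)
    (Uhat : Matrix (Fin N) (Fin n) ℝ) (hUhat : Uhatᵀ * Uhat = 1)
    (hspan : ∃ G : Matrix (Fin n) (Fin n) ℝ, IsUnit G ∧ U + ΔU = Uhat * G) :
    frobSq (Ubar - Uhat * Uhatᵀ * Ubar) ≤
      (Real.sqrt cbar₄ + specNorm (((samplingMatrix p)ᵀ * U)⁻¹) * Real.sqrt c₄) ^ 2 /
          (1 - Real.exp (-min c₅ cbar₅)) *
        ((n : ℝ) / N) * (specNorm Ftilde * specNorm (Ftilde⁻¹)) ^ 2 *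
        Real.exp (-min c₅ cbar₅ * (m : ℝ) ^ min a abar) := by
  obtain ⟨G, -, hG⟩ := hspan
  set c := min c₅ cbar₅
  set α := min a abar with hαdef
  set Λ := specNorm (((samplingMatrix p)ᵀ * U)⁻¹)
  have hc : 0 < c := lt_min hc₅ hcbar₅
  have hα : 1 ≤ α := (lt_min ha habar).le
  have hCnorm : specNorm C ≤ Λ * specNorm Ftilde := by
    have hPUbar : specNorm ((samplingMatrix p)ᵀ * Ubar) ≤ 1 := by
      refine (specNorm_mul_le _ _).trans ?_
      rw [specNorm_transpose]
      exact mul_le_one₀ (specNorm_le_one (samplingMatrix_orthonormal hp)) (specNorm_nonneg _)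
        (specNorm_le_one hUbar)
    rw [hC, hF, ← Matrix.mul_assoc (samplingMatrix p)ᵀ]
    refine (specNorm_mul_le _ _).trans (mul_le_mul_of_nonneg_left ?_ (specNorm_nonneg _))
    refine (specNorm_mul_le _ _).trans ?_
    exact mul_le_of_le_one_left (specNorm_nonneg _) hPUbar
  have hrow : ∀ i : Fin N, rowNormSq R (j i) ≤
      (√cbar₄ + Λ * √c₄) ^ 2 * ((n : ℝ) / N) * specNorm Ftilde ^ 2 *
        Real.exp (-c * (((i : ℕ) + 1 : ℕ) : ℝ) ^ α) := by
    intro i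
    have hx : (1 : ℝ) ≤ (((i : ℕ) + 1 : ℕ) : ℝ) := by norm_cast; omega
    have hUi := norm_row_le_of_coherence hN hn hc₄.le hc hx (min_le_left c₅ cbar₅)
      (min_le_left a abar) (hcoh i)
    have hUbari := norm_row_le_of_coherence hN hn hcbar₄.le hc hx (min_le_right c₅ cbar₅)
      (min_le_right a abar) (hcohbar i)
    rw [← hαdef] at hUi hUbari
    set t := (n : ℝ) / N * Real.exp (-c * (((i : ℕ) + 1 : ℕ) : ℝ) ^ α) with ht
    have ht0 : 0 ≤ t := by positivity
    have hnorm : ‖WithLp.toLp 2 (R (j i))‖ ≤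
        (√cbar₄ + Λ * √c₄) * specNorm Ftilde * √t := by
      have hRi : WithLp.toLp 2 (R (j i)) =
          WithLp.toLp 2 ((U * C) (j i)) - WithLp.toLp 2 ((Ubar * Ftilde) (j i)) := by
        rw [hR, hF]; rfl
      rw [hRi]
      calc _ ≤ ‖WithLp.toLp 2 (U (j i))‖ * specNorm C +
              ‖WithLp.toLp 2 (Ubar (j i))‖ * specNorm Ftilde :=
            (norm_sub_le _ _).trans
              (add_le_add (norm_row_mul_le _ _ _) (norm_row_mul_le _ _ _))
        _ ≤ (√c₄ * √t) * (Λ * specNorm Ftilde) + (√cbar₄ * √t) * specNorm Ftilde :=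
            add_le_add (mul_le_mul hUi hCnorm (specNorm_nonneg _) (by positivity))
              (mul_le_mul_of_nonneg_right hUbari (specNorm_nonneg _))
        _ = _ := by ring
    rw [rowNormSq_eq_norm_sq]
    refine (pow_le_pow_left₀ (norm_nonneg _) hnorm 2).trans_eq ?_
    rw [mul_pow, mul_pow, Real.sq_sqrt ht0, ht]
    ring
  have hFt' : Ftilde * Ftilde⁻¹ = 1 :=
    Matrix.mul_nonsing_inv _ ((Matrix.isUnit_iff_isUnit_det _).1 hFt)
  set E := (U + ΔU) * C - F with hE
  have hproj : Ubar - Uhat * Uhatᵀ * Ubar =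
      -(E - Uhat * Uhatᵀ * E) * Ftilde⁻¹ := by
    have h₁ : Uhat * Uhatᵀ * (Uhat * G * C) = Uhat * G * C := by
      simp only [Matrix.mul_assoc]
      rw [← Matrix.mul_assoc Uhatᵀ, hUhat, Matrix.one_mul]
    have h₂ : -(E - Uhat * Uhatᵀ * E) = (Ubar - Uhat * Uhatᵀ * Ubar) * Ftilde := by
      rw [hE, hG, hF, Matrix.mul_sub, h₁, Matrix.sub_mul, Matrix.mul_assoc _ Ubar]
      abel
    rw [h₂, Matrix.mul_assoc _ Ftilde, hFt', Matrix.mul_one]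
  have herr : frobSq (Ubar - Uhat * Uhatᵀ * Ubar) ≤ frobSq E * specNorm Ftilde⁻¹ ^ 2 := by
    rw [hproj]
    refine (frobSq_mul_le _ _).trans (mul_le_mul_of_nonneg_right ?_ (sq_nonneg _))
    rw [frobSq_neg]
    exact frobSq_sub_proj_le hUhat E
  have hsum : frobSq E = ∑ i ∈ (univ.image s)ᶜ, rowNormSq R i := by
    apply frobSq_eq_sum_compl
    · intro l
      rw [samplingMatrix_transpose_mul] at h2
      exact congrFun h2 l
    · intro i hi
      rw [← Set.mem_compl_iff, ← hcompl] at hi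
      obtain ⟨l, rfl⟩ := hi
      rw [samplingMatrix_transpose_mul] at h1
      have hΔ : (ΔU * C) (sb l) = 0 := by
        have h₀ : ∀ q, ΔU (sb l) q = 0 := fun q => congrFun (congrFun h1 l) q
        ext q
        simp [mul_apply, h₀]
      have hER : E = R + ΔU * C := by
        rw [hE, hR, Matrix.add_mul]
        abel
      rw [hER]
      change R (sb l) + (ΔU * C) (sb l) = R (sb l)
      rw [hΔ, add_zero]
  have htop : ∑ i ∈ (univ.image s)ᶜ, rowNormSq R i ≤
      ∑ i ∈ univ.filter fun i : Fin N => m ≤ (i : ℕ), rowNormSq R (j i) := by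
    set W := (univ.filter fun i : Fin N => (i : ℕ) < m).map j.toEmbedding with hW
    have hWcard : W.card = (univ.image s).card := by
      rw [hW, Finset.card_map, Finset.card_image_of_injective _ hs, Finset.card_fin,
        Fin.card_filter_val_lt, min_eq_right hm]
    have hWc : Wᶜ = (univ.filter fun i : Fin N => m ≤ (i : ℕ)).map j.toEmbedding := by
      ext x
      obtain ⟨y, rfl⟩ := j.surjective x
      simp [hW]
    refine (sum_compl_le_sum_compl_of_card_eq hWcard ?_).trans_eq ?_
    · intro k hk i hi
      obtain ⟨l, -, rfl⟩ := Finset.mem_image.1 hk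
      exact hadapt l i (by simpa using hi)
    · rw [hWc, Finset.sum_map]
      rfl
  have hfrob : frobSq E ≤ (√cbar₄ + Λ * √c₄) ^ 2 * ((n : ℝ) / N) * specNorm Ftilde ^ 2 *
      (Real.exp (-c * (m : ℝ) ^ α) / (1 - Real.exp (-c))) := by
    rw [hsum]
    refine (htop.trans (Finset.sum_le_sum fun i _ => hrow i)).trans ?_
    rw [← Finset.mul_sum]
    exact mul_le_mul_of_nonneg_left (sum_exp_neg_mul_rpow_le hc hα) (by positivity)
  refine (herr.trans (mul_le_mul_of_nonneg_right hfrob (sq_nonneg _))).trans_eq ?_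
  ring
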